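/- Let H be a graph whose vertex set is partitioned as V(H) = V₁ ∪ V₂, where V₁ induces a κ₁-regular subgraph, V₂ induces a κ₂-regular subgraph, every vertex of V₁ has exactly τ > 0 neighbors in V₂, and every vertex of V₂ has exactly s neighbors in V₁ (i.e., V₁ is a (κ₁,s)-regular set and V₂ is a (κ₂,τ)-regular set of H). If μ is a main eigenvalue of H, then μ = (κ₁ + κ₂ + √((κ₂ − κ₁)² + 4sτ))/2 or μ = (κ₁ + κ₂ − √((κ₂ − κ₁)² + 4sτ))/2. -/

import Mathlib

open SimpleGraph Matrix

/-- `S` is a `(κ,τ)`-regular set of `G`: every vertex in `S` has exactly `κ` neighbors in `S`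
and every vertex outside `S` has exactly `τ` neighbors in `S`. -/
def IsKTRegular {V : Type*} (G : SimpleGraph V) (S : Set V) (κ τ : ℕ) : Prop :=
  (∀ v ∈ S, (G.neighborSet v ∩ S).ncard = κ) ∧ ∀ v ∉ S, (G.neighborSet v ∩ S).ncard = τ

/-- The characteristic (0-1) vector of a vertex subset. -/
noncomputable def charVec {V : Type*} (S : Set V) : V → ℝ := S.indicator 1

/-- `μ` is an eigenvalue of the real matrix `A`. -/
def IsAdjEigenvalue {n : ℕ} (A : Matrix (Fin n) (Fin n) ℝ) (μ : ℝ) : Prop :=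
  ∃ v : Fin n → ℝ, v ≠ 0 ∧ A.mulVec v = μ • v

/-- `μ` is a main eigenvalue of `A`: the eigenspace of `μ` is not orthogonal to the
all-ones vector, i.e. there is an eigenvector `u` for `μ` with `uᵀ𝟙 ≠ 0`. -/
def IsMainEigenvalue {n : ℕ} (A : Matrix (Fin n) (Fin n) ℝ) (μ : ℝ) : Prop :=
  ∃ u : Fin n → ℝ, u ≠ 0 ∧ A.mulVec u = μ • u ∧ dotProduct u (fun _ => (1 : ℝ)) ≠ 0

theorem IsKTRegular.adjMatrix_mulVec_charVec {V : Type*} [Fintype V] {G : SimpleGraph V}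
    [DecidableRel G.Adj] {S : Set V} {κ τ : ℕ} (h : IsKTRegular G S κ τ) :
    G.adjMatrix ℝ *ᵥ charVec S = (κ : ℝ) • charVec S + (τ : ℝ) • charVec Sᶜ := by
  classical
  ext v
  have hcard : (G.adjMatrix ℝ *ᵥ charVec S) v = ((G.neighborSet v ∩ S).ncard : ℝ) := by
    rw [adjMatrix_mulVec_apply, Set.ncard_eq_toFinset_card']
    simp only [charVec, Set.indicator_apply, Pi.one_apply, Finset.sum_boole]
    congr 2
    ext w
    simp
  rw [hcard]
  by_cases hv : v ∈ S
  · simp [charVec, hv, h.1 v hv]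
  · simp [charVec, hv, h.2 v hv]

theorem IsKTRegular.eigenvalue_mul_dotProduct_charVec {V : Type*} [Fintype V]
    {G : SimpleGraph V} [DecidableRel G.Adj] {S : Set V} {κ τ : ℕ} (h : IsKTRegular G S κ τ)
    {u : V → ℝ} {μ : ℝ} (hu : G.adjMatrix ℝ *ᵥ u = μ • u) :
    μ * (u ⬝ᵥ charVec S) = κ * (u ⬝ᵥ charVec S) + τ * (u ⬝ᵥ charVec Sᶜ) := by
  have hsymm : (G.adjMatrix ℝ *ᵥ u) ⬝ᵥ charVec S = u ⬝ᵥ (G.adjMatrix ℝ *ᵥ charVec S) := by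
    rw [dotProduct_mulVec, ← mulVec_transpose, transpose_adjMatrix]
  rw [hu, h.adjMatrix_mulVec_charVec] at hsymm
  simpa [dotProduct_add] using hsymm

theorem charVec_add_charVec_compl {V : Type*} (S : Set V) :
    charVec S + charVec Sᶜ = fun _ => (1 : ℝ) :=
  Set.indicator_self_add_compl S 1

/-- If `V(H)` is partitioned into `V₁` (a `(κ₁,s)`-regular set) and `V₂ = V₁ᶜ`
(a `(κ₂,τ)`-regular set, `τ > 0`), then every main eigenvalue `μ` of `H` satisfies
`μ = (κ₁ + κ₂ ± √((κ₂ - κ₁)² + 4sτ))/2`. -/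
theorem main_eigenvalues_of_partition {n κ₁ κ₂ s τ : ℕ} (H : SimpleGraph (Fin n))
    [DecidableRel H.Adj] (V₁ : Set (Fin n)) (hτ : 0 < τ)
    (h1 : IsKTRegular H V₁ κ₁ s) (h2 : IsKTRegular H V₁ᶜ κ₂ τ)
    (μ : ℝ) (hμ : IsMainEigenvalue (H.adjMatrix ℝ) μ) :
    μ = ((κ₁ : ℝ) + κ₂ + Real.sqrt (((κ₂ : ℝ) - κ₁) ^ 2 + 4 * s * τ)) / 2 ∨
      μ = ((κ₁ : ℝ) + κ₂ - Real.sqrt (((κ₂ : ℝ) - κ₁) ^ 2 + 4 * s * τ)) / 2 := by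
  obtain ⟨u, -, hu, hsum⟩ := hμ
  have ha := h1.eigenvalue_mul_dotProduct_charVec hu
  have hb := h2.eigenvalue_mul_dotProduct_charVec hu
  rw [compl_compl] at hb
  rw [← charVec_add_charVec_compl V₁, dotProduct_add] at hsum
  set a := u ⬝ᵥ charVec V₁
  set b := u ⬝ᵥ charVec V₁ᶜ
  have hchar : (μ - κ₁) * (μ - κ₂) = s * τ :=
    mul_right_cancel₀ hsum (by linear_combination (μ - κ₂ + τ) * ha + (μ - κ₁ + s) * hb)
  have hsq : (2 * μ - κ₁ - κ₂) ^ 2 = Real.sqrt (((κ₂ : ℝ) - κ₁) ^ 2 + 4 * s * τ) ^ 2 := by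
    rw [Real.sq_sqrt (by positivity)]
    linear_combination 4 * hchar
  rcases sq_eq_sq_iff_eq_or_eq_neg.mp hsq with h | h
  · left; linarith
  · right; linarith
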